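/- arXiv:1310.4383 — 3 statements merged into one kernel-verified Lean document; each statement's English description precedes it below -/
import Mathlib

section
/- If T is a tree and H is a bipartite graph having Sidorenko's property, then the Cartesian product T □ H also has Sidorenko's property. -/
namespace SimpleGraph

open Finset Real
open scoped Classical

noncomputable instance homFintype {V W : Type} [Finite V] [Finite W] (F : SimpleGraph V)
    (G : SimpleGraph W) : Fintype (F →g G) := Fintype.ofFinite _

section Tree

variable {V W : Type}

/-- Homomorphisms from a graph with a leaf `l` attached at `u` are pairs of a homomorphism
from the graph without the leaf and a neighbour of the image of `u`. -/
noncomputable def homLeafEquiv (T : SimpleGraph V) (G : SimpleGraph W) {l u : V} (hlu : T.Adj l u)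
    (huniq : ∀ v, T.Adj l v → v = u) :
    (T →g G) ≃ {p : (T.induce ({l}ᶜ : Set V) →g G) × W // G.Adj (p.1 ⟨u, hlu.ne'⟩) p.2} where
  toFun f := ⟨(f.comp (Embedding.induce _).toHom, f l), f.map_adj hlu.symm⟩
  invFun p := ⟨fun v => if h : v = l then p.1.2 else p.1.1 ⟨v, h⟩, by
    rintro a b hab
    by_cases ha : a = l
    · subst ha
      have hb := huniq b hab
      subst hb
      simp only [dif_pos, dif_neg hlu.ne']
      exact p.2.symm
    · by_cases hb : b = l
      · subst hb
        have ha' := huniq a hab.symm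
        subst ha'
        simp only [dif_pos, dif_neg hlu.ne']
        exact p.2
      · simp only [dif_neg ha, dif_neg hb]
        exact p.1.1.map_adj (by simpa using hab)⟩
  left_inv f := by
    ext v
    by_cases h : v = l
    · subst h; simp
    · simp [h]
  right_inv p := by
    obtain ⟨⟨f, y⟩, hy⟩ := p
    have h1 : ∀ v : ({l}ᶜ : Set V), v.1 ≠ l := fun v => v.2
    refine Subtype.ext (Prod.ext ?_ ?_)
    · ext v
      simp [h1 v]
    · simp

/-- The leaf-removal recursion for weighted homomorphism sums. -/
theorem sum_hom_leaf [Fintype V] [Fintype W] (T : SimpleGraph V) (G : SimpleGraph W) {l u : V}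
    (hlu : T.Adj l u) (huniq : ∀ v, T.Adj l v → v = u) (a : V → W → ℝ) :
    ∑ f : T →g G, ∏ v, a v (f v) =
      ∑ f : (T.induce ({l}ᶜ : Set V) →g G), (∏ v : ({l}ᶜ : Set V), a v (f v)) *
        ∑ y ∈ G.neighborFinset (f ⟨u, hlu.ne'⟩), a l y := by
  have key : ∀ f : T →g G, ∏ v, a v (f v) =
      (fun p : (T.induce ({l}ᶜ : Set V) →g G) × W =>
        (∏ v : ({l}ᶜ : Set V), a v (p.1 v)) * a l p.2) (homLeafEquiv T G hlu huniq f).1 := by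
    intro f
    rw [← Fintype.prod_subtype_mul_prod_subtype (fun v => v ∈ ({l}ᶜ : Set V))]
    congr 1
    have hl : ∀ v : {v // ¬ v ∈ ({l}ᶜ : Set V)}, v.1 = l := fun v => by simpa using v.2
    have hun : Unique {v // ¬ v ∈ ({l}ᶜ : Set V)} :=
      ⟨⟨⟨l, by simp⟩⟩, fun v => Subtype.ext (by rw [hl v]; exact (hl _).symm)⟩
    rw [Fintype.prod_unique, hl]
    rfl
  simp_rw [key]
  rw [(homLeafEquiv T G hlu huniq).sum_comp (fun q =>
    (fun p : (T.induce ({l}ᶜ : Set V) →g G) × W =>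
        (∏ v : ({l}ᶜ : Set V), a v (p.1 v)) * a l p.2) q.1)]
  rw [← Finset.sum_subtype (univ.filter fun p : (T.induce ({l}ᶜ : Set V) →g G) × W =>
      G.Adj (p.1 ⟨u, hlu.ne'⟩) p.2) (by simp)
    (fun p : (T.induce ({l}ᶜ : Set V) →g G) × W =>
        (∏ v : ({l}ᶜ : Set V), a v (p.1 v)) * a l p.2), sum_filter, Fintype.sum_prod_type]
  refine sum_congr rfl fun f _ => ?_
  rw [mul_sum, ← sum_filter]
  refine sum_congr ?_ fun _ _ => rfl
  ext y; simp

/-- Induction for finite trees by removing a leaf. -/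
theorem IsTree.leaf_induction {P : ∀ (V : Type) [Fintype V], SimpleGraph V → Prop}
    (single : ∀ (V : Type) [Fintype V] (T : SimpleGraph V), Fintype.card V = 1 → P V T)
    (leaf : ∀ (V : Type) [Fintype V] (T : SimpleGraph V) (l u : V), T.Adj l u →
      (∀ v, T.Adj l v → v = u) →
      Fintype.card V = Fintype.card ({l}ᶜ : Set V) + 1 →
      P ({l}ᶜ : Set V) (T.induce ({l}ᶜ : Set V)) → P V T)
    [Fintype V] (T : SimpleGraph V) (hT : T.IsTree) : P V T := by
  induction h : Fintype.card V using Nat.strong_induction_on generalizing V with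
  | _ n ih =>
  have := hT.connected.nonempty
  rcases subsingleton_or_nontrivial V with hs | hn
  · exact single V T (le_antisymm (Fintype.card_le_one_iff_subsingleton.2 hs) Fintype.card_pos)
  · obtain ⟨l, -, -, hl, -⟩ := hT.exists_ne_and_degree_eq_one
    obtain ⟨u, hlu, hu⟩ := degree_eq_one_iff_existsUnique_adj.mp hl
    have hc : Fintype.card V = Fintype.card ({l}ᶜ : Set V) + 1 := by
      rw [Fintype.card_compl_set]
      have : 0 < Fintype.card V := Fintype.card_pos
      simp
      omega
    refine leaf V T l u hlu hu hc (ih _ (by omega) _ ?_ rfl)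
    exact ⟨hT.connected.induce_compl_singleton_of_degree_eq_one hl, hT.isAcyclic.induce _⟩

theorem mul_log_add_sum_log_le {s : Finset W} {b : W → ℝ} (hb : ∀ y ∈ s, 0 < b y) :
    (#s : ℝ) * log #s + ∑ y ∈ s, log (b y) ≤ #s * log (∑ y ∈ s, b y) := by
  rcases s.eq_empty_or_nonempty with rfl | hs
  · simp
  have hc : (0 : ℝ) < #s := by exact_mod_cast hs.card_pos
  have hsum : 0 < ∑ y ∈ s, b y := sum_pos hb hs
  have h := strictConcaveOn_log_Ioi.concaveOn.le_map_sum (t := s) (w := fun _ => (#s : ℝ)⁻¹)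
    (p := b) (fun _ _ => by positivity) (by simp [hc.ne']) (fun y hy => hb y hy)
  simp only [smul_eq_mul, ← mul_sum] at h
  rw [log_mul (by positivity) hsum.ne', log_inv] at h
  have h2 := mul_le_mul_of_nonneg_left h hc.le
  rw [← mul_assoc, mul_inv_cancel₀ hc.ne'] at h2
  linarith

theorem sum_neighborFinset_comm [Fintype W] (G : SimpleGraph W) (g : W → ℝ) :
    ∑ x, ∑ y ∈ G.neighborFinset x, g y = ∑ y, (G.degree y : ℝ) * g y := by
  simp_rw [neighborFinset_eq_filter, sum_filter]
  rw [sum_comm]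
  refine sum_congr rfl fun y _ => ?_
  simp_rw [G.adj_comm _ y]
  rw [← sum_filter, sum_const, nsmul_eq_mul, ← neighborFinset_eq_filter,
    card_neighborFinset_eq_degree]

theorem exp_le_sum_of_degree [Fintype W] (G : SimpleGraph W) (b : W → ℝ) (hb : ∀ x, 0 ≤ b x)
    (hb' : ∀ x, 0 < G.degree x → 0 < b x) {D : ℝ} (hD : 0 < D) (hDs : ∑ x, (G.degree x : ℝ) = D) :
    D * exp ((-(∑ x, (G.degree x : ℝ) * log (G.degree x)) +
      ∑ x, (G.degree x : ℝ) * log (b x)) / D) ≤ ∑ x, b x := by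
  have h := convexOn_exp.map_sum_le (t := (univ : Finset W)) (w := fun x => (G.degree x : ℝ) / D)
    (p := fun x => log (b x) - log (G.degree x)) (fun _ _ => by positivity)
    (by rw [← sum_div, hDs, div_self hD.ne']) (by simp)
  simp only [smul_eq_mul] at h
  have e1 : ∑ x, (G.degree x : ℝ) / D * (log (b x) - log (G.degree x)) =
      (-(∑ x, (G.degree x : ℝ) * log (G.degree x)) +
      ∑ x, (G.degree x : ℝ) * log (b x)) / D := by
    rw [← sum_neg_distrib, ← sum_add_distrib, sum_div]
    exact sum_congr rfl fun x _ => by ring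
  rw [e1] at h
  refine (mul_le_mul_of_nonneg_left h hD.le).trans ?_
  rw [mul_sum]
  refine sum_le_sum fun x _ => ?_
  rcases Nat.eq_zero_or_pos (G.degree x) with h0 | h0
  · simp [h0, hb x]
  · have hd : (0 : ℝ) < G.degree x := by exact_mod_cast h0
    rw [exp_sub, exp_log (hb' x h0), exp_log hd]
    field_simp
    exact le_rfl

/-- A logarithmic lower bound for weighted homomorphism sums from a tree. -/
theorem IsTree.exp_le_sum_hom [Fintype W] (G : SimpleGraph W) {D : ℝ} (hD : 0 < D)
    (hDs : ∑ x, (G.degree x : ℝ) = D) [Fintype V] (T : SimpleGraph V) (hT : T.IsTree) :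
    ∀ a : V → W → ℝ, (∀ v x, 0 ≤ a v x) → (∀ v x, 0 < G.degree x → 0 < a v x) →
    D * exp ((((Fintype.card V : ℝ) - 2) * (∑ x, (G.degree x : ℝ) * log (G.degree x)) +
      ∑ v, ∑ x, (G.degree x : ℝ) * log (a v x)) / D) ≤ ∑ f : T →g G, ∏ v, a v (f v) := by
  refine IsTree.leaf_induction (P := fun V _ T => ∀ a : V → W → ℝ, (∀ v x, 0 ≤ a v x) →
    (∀ v x, 0 < G.degree x → 0 < a v x) →
    D * exp ((((Fintype.card V : ℝ) - 2) * (∑ x, (G.degree x : ℝ) * log (G.degree x)) +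
      ∑ v, ∑ x, (G.degree x : ℝ) * log (a v x)) / D) ≤ ∑ f : T →g G, ∏ v, a v (f v)) ?_ ?_ T hT
  · intro V _ T hc a ha ha'
    obtain ⟨v₀, hv₀⟩ := Fintype.card_eq_one_iff.1 hc
    have : Unique V := ⟨⟨v₀⟩, hv₀⟩
    have h := exp_le_sum_of_degree G (a default) (ha _) (ha' _) hD hDs
    have e : ∑ f : T →g G, ∏ v, a v (f v) = ∑ x, a default x := by
      refine Fintype.sum_equiv ⟨fun f => f default, fun x => ⟨fun _ => x, fun {p q} h =>
        (h.ne (Subsingleton.elim _ _)).elim⟩, fun f => ?_, fun x => rfl⟩ _ _ fun f => ?_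
      · ext v
        rw [Unique.eq_default v]; rfl
      · simp
    rw [e, hc]
    convert h using 5
    · push_cast; ring
    · simp
  · intro V _ T l u hlu huniq hc ih a ha ha'
    set u' : ({l}ᶜ : Set V) := ⟨u, hlu.ne'⟩ with hu'
    set S : W → ℝ := fun x => ∑ y ∈ G.neighborFinset x, a l y with hS
    have hS0 : ∀ x, 0 ≤ S x := fun x => sum_nonneg fun y _ => ha _ _
    have hdeg : ∀ x y, y ∈ G.neighborFinset x → 0 < G.degree y := fun x y hy =>
      (G.degree_pos_iff_exists_adj y).2 ⟨x, ((G.mem_neighborFinset x y).1 hy).symm⟩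
    have hS1 : ∀ x, 0 < G.degree x → 0 < S x := fun x hx =>
      sum_pos (fun y hy => ha' _ _ (hdeg x y hy)) (card_pos.1 hx)
    have h := ih (fun v x => a v x * if v = u' then S x else 1)
      (fun v x => mul_nonneg (ha _ _) (by split_ifs <;> simp [hS0]))
      (fun v x hx => mul_pos (ha' _ _ hx) (by split_ifs <;> simp [hS1 _ hx]))
    rw [sum_hom_leaf T G hlu huniq a]
    have e : ∀ f : (T.induce ({l}ᶜ : Set V) →g G),
        ∏ v : ({l}ᶜ : Set V), (a v (f v) * if v = u' then S (f v) else 1) =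
        (∏ v : ({l}ᶜ : Set V), a v (f v)) * S (f u') := by
      intro f
      rw [prod_mul_distrib, prod_ite_eq' univ u' (fun v => S (f v))]
      simp
    simp_rw [e] at h
    refine le_trans ?_ h
    have hsplit : ∑ v, ∑ x, (G.degree x : ℝ) * log (a v x) =
        ∑ v : ({l}ᶜ : Set V), ∑ x, (G.degree x : ℝ) * log (a v x) +
          ∑ x, (G.degree x : ℝ) * log (a l x) := by
      rw [← Fintype.sum_subtype_add_sum_subtype (fun v => v ∈ ({l}ᶜ : Set V))]
      congr 1
      have hl : ∀ v : {v // ¬ v ∈ ({l}ᶜ : Set V)}, v.1 = l := fun v => by simpa using v.2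
      have hun : Unique {v // ¬ v ∈ ({l}ᶜ : Set V)} :=
        ⟨⟨⟨l, by simp⟩⟩, fun v => Subtype.ext (by rw [hl v]; exact (hl _).symm)⟩
      rw [Fintype.sum_unique, hl]
    have hlog : ∑ v : ({l}ᶜ : Set V), ∑ x, (G.degree x : ℝ) *
          log (a v x * if v = u' then S x else 1) =
        ∑ v : ({l}ᶜ : Set V), ∑ x, (G.degree x : ℝ) * log (a v x) +
          ∑ x, (G.degree x : ℝ) * log (S x) := by
      have : ∀ v : ({l}ᶜ : Set V), ∑ x, (G.degree x : ℝ) *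
          log (a v x * if v = u' then S x else 1) = ∑ x, (G.degree x : ℝ) * log (a v x) +
          if v = u' then ∑ x, (G.degree x : ℝ) * log (S x) else 0 := by
        intro v
        split_ifs with hv
        · rw [← sum_add_distrib]
          refine sum_congr rfl fun x _ => ?_
          rcases Nat.eq_zero_or_pos (G.degree x) with h0 | h0
          · simp [h0]
          · rw [log_mul (ha' _ _ h0).ne' (hS1 _ h0).ne']; ring
        · simp
      simp_rw [this]
      rw [sum_add_distrib]
      simp
    have hJ : ∑ x, (G.degree x : ℝ) * log (G.degree x) + ∑ x, (G.degree x : ℝ) * log (a l x) ≤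
        ∑ x, (G.degree x : ℝ) * log (S x) := by
      rw [← sum_neighborFinset_comm G (fun y => log (a l y)), ← sum_add_distrib]
      refine sum_le_sum fun x _ => ?_
      exact mul_log_add_sum_log_le (s := G.neighborFinset x) (b := a l)
        fun y hy => ha' _ _ (hdeg x y hy)
    refine mul_le_mul_of_nonneg_left (exp_le_exp.2 (div_le_div_of_nonneg_right ?_ hD.le)) hD.le
    rw [hlog, hsplit, hc]
    push_cast
    linarith

theorem natCard_dart_eq_sum_degree [Fintype W] (G : SimpleGraph W) :
    Nat.card G.Dart = ∑ x, G.degree x := by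
  rw [Nat.card_eq_fintype_card, dart_card_eq_sum_degrees]

/-- Trees have Sidorenko's property. -/
theorem IsTree.card_dart_pow_mul_le [Fintype W] (G : SimpleGraph W) [Fintype V]
    (T : SimpleGraph V) (hT : T.IsTree) {t : ℕ} (ht : Fintype.card V = t + 1) :
    Nat.card G.Dart ^ t * Fintype.card W ≤ Nat.card (T →g G) * Fintype.card W ^ t := by
  rcases t with _ | t
  · have : Subsingleton V := Fintype.card_le_one_iff_subsingleton.1 (by omega)
    have hne : Nonempty V := hT.connected.nonempty
    rw [pow_zero, pow_zero, one_mul, mul_one, ← Nat.card_eq_fintype_card]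
    refine Nat.card_le_card_of_injective (fun x => (⟨fun _ => x, fun {p q} h =>
        (h.ne (Subsingleton.elim _ _)).elim⟩ : T →g G)) fun x y hxy => ?_
    exact congrArg (fun f : T →g G => f hne.some) hxy
  rcases Nat.eq_zero_or_pos (Nat.card G.Dart) with h0 | h0
  · rw [h0, zero_pow (by omega), zero_mul]
    exact Nat.zero_le _
  set D : ℝ := (Nat.card G.Dart : ℝ) with hDdef
  have hD : 0 < D := Nat.cast_pos.2 h0
  have hDs : ∑ x, (G.degree x : ℝ) = D := by
    rw [hDdef, natCard_dart_eq_sum_degree]; push_cast; rfl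
  have hW : 0 < Fintype.card W := by
    have : Nonempty G.Dart := (Nat.card_pos_iff.1 h0).1
    exact Fintype.card_pos_iff.2 ⟨this.some.fst⟩
  set n : ℝ := (Fintype.card W : ℝ) with hn
  have hn0 : 0 < n := Nat.cast_pos.2 hW
  have h := IsTree.exp_le_sum_hom G hD hDs T hT (fun _ _ => 1) (by simp) (by simp)
  simp only [log_one, mul_zero, sum_const_zero, add_zero, prod_const_one, sum_const, card_univ,
    nsmul_eq_mul, mul_one] at h
  rw [← Nat.card_eq_fintype_card (α := T →g G), ht] at h
  have hL : D * log (D / n) ≤ ∑ x, (G.degree x : ℝ) * log (G.degree x) := by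
    have : ∑ x, ((G.degree x : ℝ) - D / n) ≤
        ∑ x, ((G.degree x : ℝ) * log (G.degree x) - G.degree x * log (D / n)) := by
      refine sum_le_sum fun x _ => ?_
      rcases Nat.eq_zero_or_pos (G.degree x) with h0 | h0
      · simp only [h0, Nat.cast_zero, zero_mul, zero_sub, sub_zero, Left.neg_nonpos_iff]
        positivity
      · have hd : (0 : ℝ) < G.degree x := by exact_mod_cast h0
        have := one_sub_inv_le_log_of_pos (x := (G.degree x : ℝ) / (D / n)) (by positivity)
        rw [log_div hd.ne' (by positivity)] at this
        have h3 := mul_le_mul_of_nonneg_left this hd.le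
        have h4 : (G.degree x : ℝ) * (1 - (G.degree x / (D / n))⁻¹) = G.degree x - D / n := by
          field_simp
        linarith
    rw [sum_sub_distrib, sum_sub_distrib, ← sum_mul, hDs, sum_const, card_univ, nsmul_eq_mul,
      mul_div_cancel₀ _ hn0.ne'] at this
    linarith
  have h2 : D * (D / n) ^ t ≤ Nat.card (T →g G) := by
    refine le_trans ?_ h
    gcongr
    rw [← exp_log (show 0 < D / n by positivity), ← exp_nat_mul]
    gcongr
    rw [le_div_iff₀ hD]
    push_cast
    have : (t : ℝ) * (D * log (D / n)) ≤ t * ∑ x, (G.degree x : ℝ) * log (G.degree x) := by gcongr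
    linarith
  rw [div_pow, mul_div_assoc', div_le_iff₀ (by positivity)] at h2
  have h3 : D ^ (t + 1) * n ≤ Nat.card (T →g G) * n ^ (t + 1) := by
    calc D ^ (t + 1) * n = (D * D ^ t) * n := by ring
      _ ≤ (Nat.card (T →g G) * n ^ t) * n := by gcongr
      _ = _ := by ring
  rw [hDdef, hn] at h3
  exact_mod_cast h3

/-- The number of homomorphisms from a tree into a graph of bounded degree. -/
theorem IsTree.card_hom_le [Fintype W] (G : SimpleGraph W) {k : ℕ} (hk : ∀ x, G.degree x ≤ k)
    [Fintype V] (T : SimpleGraph V) (hT : T.IsTree) {t : ℕ} (ht : Fintype.card V = t + 1) :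
    Nat.card (T →g G) ≤ Fintype.card W * k ^ t := by
  revert t
  refine IsTree.leaf_induction (P := fun V _ T => ∀ {t : ℕ}, Fintype.card V = t + 1 →
    Nat.card (T →g G) ≤ Fintype.card W * k ^ t) ?_ ?_ T hT
  · intro V _ T hc t ht
    obtain rfl : t = 0 := by omega
    have : Subsingleton V := Fintype.card_le_one_iff_subsingleton.1 hc.le
    obtain ⟨v₀, hv₀⟩ := Fintype.card_eq_one_iff.1 hc
    rw [pow_zero, mul_one, ← Nat.card_eq_fintype_card]
    refine Nat.card_le_card_of_injective (fun f : T →g G => f v₀) fun f g hfg => ?_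
    ext v
    rw [hv₀ v]
    exact hfg
  · intro V _ T l u hlu huniq hc ih t ht
    have : Nontrivial V := ⟨l, u, hlu.ne⟩
    have := Fintype.one_lt_card (α := V)
    obtain ⟨s, rfl⟩ : ∃ s, t = s + 1 := ⟨t - 1, by omega⟩
    have h1 := ih (t := s) (by omega)
    have h2 := sum_hom_leaf T G hlu huniq (fun _ _ => 1)
    simp only [prod_const_one, sum_const, one_mul, card_univ, nsmul_eq_mul, mul_one,
      card_neighborFinset_eq_degree, ← Nat.card_eq_fintype_card] at h2
    have h3 : (Nat.card (T →g G)) =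
      ∑ f : (T.induce ({l}ᶜ : Set V) →g G), G.degree (f ⟨u, hlu.ne'⟩) := by exact_mod_cast h2
    rw [h3]
    refine (sum_le_sum fun f _ => hk _).trans ?_
    rw [sum_const, card_univ, ← Nat.card_eq_fintype_card, smul_eq_mul, pow_succ, ← mul_assoc]
    gcongr

end Tree

section HomGraph

variable {V W U : Type}

/-- The tensor power of `G` indexed by `ι`: functions into `G`, adjacent when they are adjacent at
every index. -/
def piGraph (ι : Type) [Nonempty ι] (G : SimpleGraph W) : SimpleGraph (ι → W) where
  Adj f g := ∀ i, G.Adj (f i) (g i)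
  symm := ⟨fun _ _ h i => (h i).symm⟩
  loopless := ⟨fun _ h => G.irrefl (h (Classical.arbitrary ι))⟩

/-- The graph of homomorphisms from `T` to `G`, adjacent when they are adjacent pointwise. -/
def homGraph [Nonempty V] (T : SimpleGraph V) (G : SimpleGraph W) : SimpleGraph (T →g G) :=
  (piGraph V G).comap fun f : T →g G => (f : V → W)

/-- The graph on the darts of `G` whose edges are pairs of opposite sides of a four-cycle. -/
def dartGraph (G : SimpleGraph W) : SimpleGraph G.Dart where
  Adj d e := G.Adj d.fst e.fst ∧ G.Adj d.snd e.snd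
  symm := ⟨fun _ _ h => ⟨h.1.symm, h.2.symm⟩⟩
  loopless := ⟨fun _ h => G.irrefl h.1⟩

theorem card_hom_homGraph_le [Nonempty V] [Finite V] [Finite U] [Finite W] (T : SimpleGraph V)
    (H : SimpleGraph U) (G : SimpleGraph W) :
    Nat.card (H →g homGraph T G) ≤ Nat.card (T.boxProd H →g G) := by
  refine Nat.card_le_card_of_injective (fun φ => (⟨fun p => φ p.2 p.1, ?_⟩ : T.boxProd H →g G)) ?_
  · rintro ⟨a, b⟩ ⟨c, d⟩ h
    rcases boxProd_adj.1 h with ⟨h, rfl⟩ | ⟨h, rfl⟩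
    · exact (φ b).map_adj h
    · exact φ.map_adj h a
  · intro φ ψ h
    ext u v
    exact congrArg (fun f : T.boxProd H →g G => f (v, u)) h

theorem card_hom_dartGraph_le [Nonempty V] [Finite V] [Finite W] (T : SimpleGraph V)
    (G : SimpleGraph W) : Nat.card (T →g dartGraph G) ≤ Nat.card (homGraph T G).Dart := by
  have : Fintype W := Fintype.ofFinite _
  refine Nat.card_le_card_of_injective (fun φ => (⟨(⟨fun v => (φ v).fst, fun h => (φ.map_adj h).1⟩,
    ⟨fun v => (φ v).snd, fun h => (φ.map_adj h).2⟩), fun v => (φ v).adj⟩ : (homGraph T G).Dart)) ?_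
  intro φ ψ h
  refine RelHom.ext fun v => Dart.ext _ _ (Prod.ext ?_ ?_)
  · exact congrArg (fun d : (homGraph T G).Dart => d.fst v) h
  · exact congrArg (fun d : (homGraph T G).Dart => d.snd v) h

/-- The four-cycle has Sidorenko's property. -/
theorem card_dart_pow_four_le [Fintype W] (G : SimpleGraph W) :
    Nat.card G.Dart ^ 4 ≤ Nat.card (dartGraph G).Dart * Fintype.card W ^ 4 := by
  set c : W × W → ℕ := fun p => #{x | G.Adj p.1 x ∧ G.Adj x p.2} with hc
  have h1 : ∑ p, c p = ∑ x, G.degree x ^ 2 := by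
    simp only [hc, card_filter]
    rw [sum_comm]
    refine sum_congr rfl fun x _ => ?_
    rw [Fintype.sum_prod_type, sq, degree, neighborFinset_eq_filter, card_filter, sum_mul_sum]
    refine sum_congr rfl fun a _ => sum_congr rfl fun b _ => ?_
    simp only [G.adj_comm a x]
    split_ifs <;> simp_all
  have h2 : ∑ p, c p ^ 2 ≤ Nat.card (dartGraph G).Dart := by
    have : ∑ p, c p ^ 2 = Nat.card (Σ p : W × W, {x // G.Adj p.1 x ∧ G.Adj x p.2} ×
        {x // G.Adj p.1 x ∧ G.Adj x p.2}) := by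
      rw [Nat.card_eq_fintype_card, Fintype.card_sigma]
      refine sum_congr rfl fun p _ => ?_
      rw [Fintype.card_prod, Fintype.card_subtype, sq]
    rw [this]
    refine Nat.card_le_card_of_injective (fun q => (⟨(⟨(q.1.1, q.2.1.1), q.2.1.2.1⟩,
      ⟨(q.2.2.1, q.1.2), q.2.2.2.2⟩), ⟨q.2.2.2.1, q.2.1.2.2⟩⟩ : (dartGraph G).Dart)) ?_
    rintro ⟨⟨a, b⟩, ⟨x, hx⟩, ⟨y, hy⟩⟩ ⟨⟨a', b'⟩, ⟨x', hx'⟩, ⟨y', hy'⟩⟩ h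
    cases h
    rfl
  have h3 := sq_sum_le_card_mul_sum_sq (s := (univ : Finset W)) (f := fun x => G.degree x)
  have h4 := sq_sum_le_card_mul_sum_sq (s := (univ : Finset (W × W))) (f := c)
  rw [← natCard_dart_eq_sum_degree, ← h1, card_univ, Nat.cast_id] at h3
  rw [card_univ, Fintype.card_prod, Nat.cast_id] at h4
  calc Nat.card G.Dart ^ 4 = (Nat.card G.Dart ^ 2) ^ 2 := by ring
    _ ≤ (Fintype.card W * ∑ p, c p) ^ 2 := by gcongr
    _ = Fintype.card W ^ 2 * (∑ p, c p) ^ 2 := by ring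
    _ ≤ Fintype.card W ^ 2 * (Fintype.card W * Fintype.card W * ∑ p, c p ^ 2) := by gcongr
    _ = (∑ p, c p ^ 2) * Fintype.card W ^ 4 := by ring
    _ ≤ _ := by gcongr

/-- Sidorenko's property of the product of a tree with an edge. -/
theorem IsTree.card_dart_pow_le_card_dart_homGraph [Fintype W] (G : SimpleGraph W) [Fintype V]
    [Nonempty V] (T : SimpleGraph V) (hT : T.IsTree) {t : ℕ} (ht : Fintype.card V = t + 1) :
    Nat.card G.Dart ^ (3 * t + 1) ≤
      Nat.card (homGraph T G).Dart * Fintype.card W ^ (4 * t) := by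
  rcases Nat.eq_zero_or_pos (Nat.card G.Dart) with h0 | h0
  · rw [h0, zero_pow (by omega)]
    exact Nat.zero_le _
  have hA := IsTree.card_dart_pow_mul_le (dartGraph G) T hT ht
  rw [← Nat.card_eq_fintype_card] at hA
  have hC := card_dart_pow_four_le G
  have hQ := card_hom_dartGraph_le T G
  refine Nat.le_of_mul_le_mul_right ?_ (pow_pos h0 t)
  calc Nat.card G.Dart ^ (3 * t + 1) * Nat.card G.Dart ^ t
      = (Nat.card G.Dart ^ 4) ^ t * Nat.card G.Dart := by ring
    _ ≤ (Nat.card (dartGraph G).Dart * Fintype.card W ^ 4) ^ t * Nat.card G.Dart := by gcongr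
    _ = (Nat.card (dartGraph G).Dart ^ t * Nat.card G.Dart) * Fintype.card W ^ (4 * t) := by ring
    _ ≤ (Nat.card (T →g dartGraph G) * Nat.card G.Dart ^ t) * Fintype.card W ^ (4 * t) := by gcongr
    _ ≤ (Nat.card (homGraph T G).Dart * Nat.card G.Dart ^ t) * Fintype.card W ^ (4 * t) := by
      gcongr
    _ = _ := by ring

theorem card_hom_piGraph_le [Finite U] [Finite W] (F : SimpleGraph U) (G : SimpleGraph W) (N : ℕ)
    [NeZero N] : Nat.card (F →g piGraph (Fin N) G) ≤ Nat.card (F →g G) ^ N := by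
  have : Nat.card (Fin N → (F →g G)) = Nat.card (F →g G) ^ N := by simp
  rw [← this]
  refine Nat.card_le_card_of_injective
    (fun φ i => (⟨fun u => φ u i, fun h => φ.map_adj h i⟩ : F →g G)) fun φ ψ h => ?_
  ext u i
  exact congrArg (fun f : F →g G => f u) (congrFun h i)

theorem card_dart_pow_le_card_dart_piGraph [Finite W] (G : SimpleGraph W) (N : ℕ) [NeZero N] :
    Nat.card G.Dart ^ N ≤ Nat.card (piGraph (Fin N) G).Dart := by
  have : Fintype W := Fintype.ofFinite _
  have : Nat.card (Fin N → G.Dart) = Nat.card G.Dart ^ N := by simp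
  rw [← this]
  refine Nat.card_le_card_of_injective
    (fun d => (⟨(fun i => (d i).fst, fun i => (d i).snd), fun i => (d i).adj⟩ :
      (piGraph (Fin N) G).Dart)) fun d e h => ?_
  refine funext fun i => Dart.ext _ _ (Prod.ext ?_ ?_)
  · exact congrArg (fun d : (piGraph (Fin N) G).Dart => d.fst i) h
  · exact congrArg (fun d : (piGraph (Fin N) G).Dart => d.snd i) h

theorem le_of_forall_pow_le_mul_pow {a b C : ℕ} (h : ∀ N : ℕ, N ≠ 0 → a ^ N ≤ C * b ^ N) :
    a ≤ b := by
  by_contra! hab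
  have h1 := h 1 one_ne_zero
  rcases Nat.eq_zero_or_pos b with rfl | hb
  · simp at h1; omega
  have hb' : (0 : ℝ) < b := by exact_mod_cast hb
  obtain ⟨N, hN⟩ := pow_unbounded_of_one_lt (C : ℝ) (y := (a : ℝ) / b)
    (by rw [one_lt_div hb']; exact_mod_cast hab)
  rcases Nat.eq_zero_or_pos N with rfl | hN0
  · have : C = 0 := by
      have : (C : ℝ) < 1 := by simpa using hN
      exact Nat.lt_one_iff.1 (by exact_mod_cast this)
    subst this
    simp at h1; omega
  · have h2 : (a : ℝ) ^ N ≤ C * b ^ N := by exact_mod_cast h N hN0.ne'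
    rw [div_pow, lt_div_iff₀ (by positivity)] at hN
    linarith

/-- The tensor-power argument: a constant factor can be removed. -/
theorem sidorenko_of_const [Finite U] (F : SimpleGraph U) (C p q : ℕ)
    (h : ∀ (W : Type) [Fintype W] (G : SimpleGraph W),
      Nat.card G.Dart ^ p ≤ C * (Nat.card (F →g G) * Fintype.card W ^ q))
    [Fintype W] (G : SimpleGraph W) :
    Nat.card G.Dart ^ p ≤ Nat.card (F →g G) * Fintype.card W ^ q := by
  refine le_of_forall_pow_le_mul_pow (C := C) fun N hN => ?_
  have : NeZero N := ⟨hN⟩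
  have h1 := h (Fin N → W) (piGraph (Fin N) G)
  rw [Fintype.card_fun, Fintype.card_fin] at h1
  calc (Nat.card G.Dart ^ p) ^ N = (Nat.card G.Dart ^ N) ^ p := by ring
    _ ≤ Nat.card (piGraph (Fin N) G).Dart ^ p := by
      gcongr; exact card_dart_pow_le_card_dart_piGraph G N
    _ ≤ _ := h1
    _ ≤ C * (Nat.card (F →g G) ^ N * (Fintype.card W ^ N) ^ q) := by
      gcongr; exact card_hom_piGraph_le F G N
    _ = _ := by ring

end HomGraph

section Split

variable {W : Type} [Fintype W]

/-- Split every vertex `x` into copies that share out its incident edges in groups of size at most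
`k`, according to an enumeration `r x` of the neighbours of `x`. -/
def splitGraph (G : SimpleGraph W) (r : W → W → ℕ) (k : ℕ) :
    SimpleGraph (Σ x : W, Fin ((G.degree x + (k - 1)) / k)) where
  Adj p q := G.Adj p.1 q.1 ∧ r p.1 q.1 / k = p.2 ∧ r q.1 p.1 / k = q.2
  symm := ⟨fun _ _ h => ⟨h.1.symm, h.2.2, h.2.1⟩⟩
  loopless := ⟨fun _ h => G.irrefl h.1⟩

theorem exists_neighbor_enumeration (G : SimpleGraph W) : ∃ r : W → W → ℕ,
    (∀ x y, G.Adj x y → r x y < G.degree x) ∧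
    ∀ x y z, G.Adj x y → G.Adj x z → r x y = r x z → y = z := by
  refine ⟨fun x y => if h : y ∈ G.neighborFinset x then (G.neighborFinset x).equivFin ⟨y, h⟩ else 0,
    fun x y h => ?_, fun x y z hy hz h => ?_⟩
  · beta_reduce
    rw [dif_pos ((G.mem_neighborFinset x y).2 h)]
    exact Fin.is_lt _
  · beta_reduce at h
    rw [dif_pos ((G.mem_neighborFinset x y).2 hy), dif_pos ((G.mem_neighborFinset x z).2 hz)] at h
    simpa using (G.neighborFinset x).equivFin.injective (Fin.ext h)

theorem card_hom_splitGraph_le {U : Type} [Finite U] (F : SimpleGraph U)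
    (hF : ∀ u, ∃ v, F.Adj u v) (G : SimpleGraph W) (r : W → W → ℕ) (k : ℕ) :
    Nat.card (F →g splitGraph G r k) ≤ Nat.card (F →g G) := by
  refine Nat.card_le_card_of_injective
    (fun φ => (⟨fun u => (φ u).1, fun h => (φ.map_adj h).1⟩ : F →g G)) fun φ ψ h => ?_
  have h1 : ∀ u, (φ u).1 = (ψ u).1 := fun u => congrArg (fun f : F →g G => f u) h
  ext u : 1
  obtain ⟨v, huv⟩ := hF u
  have e1 := (φ.map_adj huv).2.1
  have e2 := (ψ.map_adj huv).2.1
  refine Sigma.ext (h1 u) ?_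
  rw [Fin.heq_ext_iff (by rw [h1 u]), ← e1, ← e2, h1 u, h1 v]

theorem card_dart_le_card_dart_splitGraph (G : SimpleGraph W) {r : W → W → ℕ} {k : ℕ} (hk : 0 < k)
    (hr : ∀ x y, G.Adj x y → r x y < G.degree x) :
    Nat.card G.Dart ≤ Nat.card (splitGraph G r k).Dart := by
  have hlt : ∀ x y, G.Adj x y → r x y / k < (G.degree x + (k - 1)) / k := by
    intro x y h
    rw [Nat.lt_iff_add_one_le, Nat.le_div_iff_mul_le hk, add_mul, one_mul]
    have := Nat.div_mul_le_self (r x y) k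
    have := hr x y h
    omega
  refine Nat.card_le_card_of_injective (fun d => (⟨(⟨d.fst, ⟨r d.fst d.snd / k, hlt _ _ d.adj⟩⟩,
    ⟨d.snd, ⟨r d.snd d.fst / k, hlt _ _ d.adj.symm⟩⟩), ⟨d.adj, rfl, rfl⟩⟩ :
      (splitGraph G r k).Dart)) fun d e h => Dart.ext _ _ (Prod.ext ?_ ?_)
  · exact congrArg (fun d : (splitGraph G r k).Dart => d.fst.1) h
  · exact congrArg (fun d : (splitGraph G r k).Dart => d.snd.1) h

theorem degree_splitGraph_le (G : SimpleGraph W) {r : W → W → ℕ} {k : ℕ} (hk : 0 < k)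
    (hr : ∀ x y z, G.Adj x y → G.Adj x z → r x y = r x z → y = z)
    (p : Σ x : W, Fin ((G.degree x + (k - 1)) / k)) : (splitGraph G r k).degree p ≤ k := by
  have hc : #(Finset.Ico (p.2 * k : ℕ) (p.2 * k + k)) = k := by simp
  rw [degree]
  refine (card_le_card_of_injOn (fun q => r p.1 q.1) (t := Finset.Ico (p.2 * k : ℕ) (p.2 * k + k))
    ?_ ?_).trans hc.le
  · intro q hq
    have h := (mem_neighborFinset _ _ _).1 (mem_coe.1 hq)
    have h2 := (Nat.div_eq_iff hk).1 h.2.1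
    simp only [coe_Ico, Set.mem_Ico]
    omega
  · intro q hq q' hq' h
    have h1 := (mem_neighborFinset _ _ _).1 (mem_coe.1 hq)
    have h2 := (mem_neighborFinset _ _ _).1 (mem_coe.1 hq')
    have h3 := hr _ _ _ h1.1 h2.1 h
    have e1 := h1.2.2
    have e2 := h2.2.2
    refine Sigma.ext h3 ?_
    rw [Fin.heq_ext_iff (by rw [h3]), ← e1, ← e2, h3]

/-- Reduction to graphs whose maximum degree is bounded in terms of the average degree. -/
theorem exists_bounded_degree (G : SimpleGraph W) (hD : 0 < Nat.card G.Dart) :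
    ∃ (W' : Type) (_ : Fintype W') (G' : SimpleGraph W') (n k : ℕ), 0 < n ∧ n ≤ Fintype.card W ∧
      Fintype.card W' ≤ 2 * n ∧ k * n ≤ 2 * Nat.card G.Dart ∧ (∀ x, G'.degree x ≤ k) ∧
      Nat.card G.Dart ≤ Nat.card G'.Dart ∧
      ∀ (U : Type) [Finite U] (F : SimpleGraph U), (∀ u, ∃ v, F.Adj u v) →
        Nat.card (F →g G') ≤ Nat.card (F →g G) := by
  obtain ⟨r, hr1, hr2⟩ := exists_neighbor_enumeration G
  set D := Nat.card G.Dart with hDdef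
  set n := #{x | 0 < G.degree x} with hn
  have hDs : D = ∑ x, G.degree x := natCard_dart_eq_sum_degree G
  have hns : n = ∑ x, if 0 < G.degree x then 1 else 0 := by rw [hn, card_filter]
  have hn0 : 0 < n := by
    rw [hn, card_pos]
    by_contra hne
    rw [not_nonempty_iff_eq_empty, filter_eq_empty_iff] at hne
    rw [hDs, sum_eq_zero fun x hx => Nat.eq_zero_of_not_pos (hne hx)] at hD
    exact hD.false
  have hnD : n ≤ D := by
    rw [hDs, hns]
    refine sum_le_sum fun x _ => ?_
    split_ifs <;> omega
  set k := D / n + 1 with hk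
  have hk1 : k * n ≤ 2 * D := by
    have := Nat.div_mul_le_self D n
    rw [hk, add_mul, one_mul]
    omega
  have hk2 : D ≤ k * n := (Nat.lt_div_mul_add hn0).le.trans (by rw [hk, add_mul, one_mul])
  have hk0 : 0 < k := Nat.succ_pos _
  refine ⟨_, inferInstance, splitGraph G r k, n, k, hn0, card_filter_le _ _, ?_, hk1,
    degree_splitGraph_le G hk0 hr2, card_dart_le_card_dart_splitGraph G hk0 hr1,
    fun U _ F hF => card_hom_splitGraph_le F hF G r k⟩
  rw [Fintype.card_sigma]
  simp only [Fintype.card_fin]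
  refine Nat.le_of_mul_le_mul_left ?_ hk0
  calc k * ∑ x, (G.degree x + (k - 1)) / k
      ≤ ∑ x, (G.degree x + k * if 0 < G.degree x then 1 else 0) := by
        rw [mul_sum]
        refine sum_le_sum fun x _ => ?_
        split_ifs with h
        · have := Nat.mul_div_le (G.degree x + (k - 1)) k
          omega
        · have h0 : G.degree x = 0 := by omega
          rw [h0, Nat.div_eq_of_lt (by omega)]
          simp
    _ = D + k * n := by rw [sum_add_distrib, ← mul_sum, ← hDs, ← hns]
    _ ≤ k * (2 * n) := by
      have : k * (2 * n) = k * n + k * n := by ring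
      omega

end Split

section Main

variable {VT VH W : Type} [Fintype VT] [Fintype VH]

theorem two_mul_card_edgeSet [Fintype W] (G : SimpleGraph W) :
    2 * Nat.card G.edgeSet = Nat.card G.Dart := by
  rw [Nat.card_eq_fintype_card, Nat.card_eq_fintype_card, dart_card_eq_twice_card_edges,
    edgeFinset_card]

theorem density_inequality_iff [Fintype W] [Nonempty W] (G : SimpleGraph W) (X v e : ℕ) :
    (X : ℝ) / (Fintype.card W : ℝ) ^ v ≥
        (2 * (Nat.card G.edgeSet : ℝ) / (Fintype.card W : ℝ) ^ 2) ^ e ↔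
      Nat.card G.Dart ^ e * Fintype.card W ^ v ≤ X * Fintype.card W ^ (2 * e) := by
  have hW : (0 : ℝ) < Fintype.card W := by exact_mod_cast Fintype.card_pos
  have hD : 2 * (Nat.card G.edgeSet : ℝ) = Nat.card G.Dart := by
    exact_mod_cast two_mul_card_edgeSet G
  rw [hD, ge_iff_le, div_pow, ← pow_mul, div_le_div_iff₀ (by positivity) (by positivity)]
  norm_cast

theorem IsTree.card_edgeSet_boxProd {T : SimpleGraph VT} (hT : T.IsTree) (H : SimpleGraph VH)
    {t : ℕ} (ht : Fintype.card VT = t + 1) :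
    Nat.card (T.boxProd H).edgeSet =
      t * Fintype.card VH + (t + 1) * Nat.card H.edgeSet := by
  have h1 := two_mul_card_edgeSet (T.boxProd H)
  have h2 := two_mul_card_edgeSet T
  have h3 := two_mul_card_edgeSet H
  have h4 : Nat.card T.edgeSet = t := by
    have := hT.card_edgeFinset
    rw [edgeFinset_card, ← Nat.card_eq_fintype_card] at this
    omega
  have h5 : Nat.card (T.boxProd H).Dart =
      Fintype.card VH * Nat.card T.Dart + Fintype.card VT * Nat.card H.Dart := by
    rw [natCard_dart_eq_sum_degree, natCard_dart_eq_sum_degree, natCard_dart_eq_sum_degree]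
    have hsum : ∑ x, (T.boxProd H).degree x = ∑ x : VT × VH, (T.degree x.1 + H.degree x.2) :=
      sum_congr rfl fun x _ => by rw [degree_boxProd]
    have hprod : ∀ (f : VT → ℕ) (g : VH → ℕ), ∑ x : VT × VH, (f x.1 + g x.2) =
        Fintype.card VH * ∑ a, f a + Fintype.card VT * ∑ b, g b := by
      intro f g
      rw [Fintype.sum_prod_type]
      simp only [sum_add_distrib, sum_const, card_univ, smul_eq_mul, ← mul_sum]
    exact Eq.trans (by congr!) (hsum.trans (hprod (fun a => T.degree a) fun b => H.degree b))
  rw [h5, ← h2, ← h3, h4, ht] at h1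
  nlinarith

variable (T : SimpleGraph VT) (H : SimpleGraph VH) {m : ℕ}

/-- Applying the inequality for `H` to the graph of homomorphisms from `T`. -/
theorem card_dart_homGraph_pow_mul_le [Nonempty VT]
    (hH : ∀ (W : Type) [Fintype W] [Nonempty W] (G : SimpleGraph W),
      Nat.card G.Dart ^ m * Fintype.card W ^ Fintype.card VH ≤
        Nat.card (H →g G) * Fintype.card W ^ (2 * m))
    [Fintype W] (G : SimpleGraph W) (hN : 0 < Nat.card (T →g G)) :
    Nat.card (homGraph T G).Dart ^ m * Nat.card (T →g G) ^ Fintype.card VH ≤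
      Nat.card (T.boxProd H →g G) * Nat.card (T →g G) ^ (2 * m) := by
  have : Nonempty (T →g G) := (Nat.card_pos_iff.1 hN).1
  have h := hH (T →g G) (homGraph T G)
  rw [← Nat.card_eq_fintype_card] at h
  exact h.trans (by gcongr; exact card_hom_homGraph_le T H G)

variable {T}

theorem IsTree.card_hom_pos [Fintype W] (hT : T.IsTree) {G : SimpleGraph W}
    (hD : 0 < Nat.card G.Dart) : 0 < Nat.card (T →g G) := by
  have : Nonempty VT := hT.connected.nonempty
  obtain ⟨t, ht⟩ := Nat.exists_eq_add_one.2 (Fintype.card_pos (α := VT))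
  have hW : 0 < Fintype.card W := Fintype.card_pos_iff.2 ⟨(Nat.card_pos_iff.1 hD).1.some.fst⟩
  have h := IsTree.card_dart_pow_mul_le G T hT ht
  exact Nat.pos_of_mul_pos_right (lt_of_lt_of_le (by positivity) h)

/-- The inequality for `T □ H` up to a constant factor, when `H` has few vertices. -/
theorem IsTree.boxProd_inequality_up_to_const (hT : T.IsTree) {j s : ℕ}
    (ht : Fintype.card VT = j + 2) (hs : 2 * m = Fintype.card VH + s) (hm : 0 < m)
    (hH : ∀ (W : Type) [Fintype W] [Nonempty W] (G : SimpleGraph W),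
      Nat.card G.Dart ^ m * Fintype.card W ^ Fintype.card VH ≤
        Nat.card (H →g G) * Fintype.card W ^ (2 * m))
    (W : Type) [Fintype W] (G : SimpleGraph W) :
    Nat.card G.Dart ^ ((j + 1) * Fintype.card VH + (j + 2) * m) ≤
      2 ^ (4 * (j + 1) * m + s + (j + 1) * s) * (Nat.card (T.boxProd H →g G) *
        Fintype.card W ^ ((2 * j + 4) * m + j * Fintype.card VH)) := by
  have : Nonempty VT := hT.connected.nonempty
  rcases Nat.eq_zero_or_pos (Nat.card G.Dart) with h0 | hD
  · rw [h0, zero_pow (by positivity)]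
    exact Nat.zero_le _
  obtain ⟨W', _, G', n, k, hn, hnW, hW', hk, hdeg, hDD, hhom⟩ := exists_bounded_degree G hD
  have hX := hhom _ (T.boxProd H) fun p => by
    have : Nontrivial VT := Fintype.one_lt_card_iff_nontrivial.1 (by omega)
    obtain ⟨v, hv⟩ := hT.connected.preconnected.exists_adj_of_nontrivial p.1
    exact ⟨(v, p.2), boxProd_adj.2 (Or.inl ⟨hv, rfl⟩)⟩
  have hN := hT.card_hom_pos (hD.trans_le hDD)
  have h1 := card_dart_homGraph_pow_mul_le T H hH G' hN
  have hB := hT.card_dart_pow_le_card_dart_homGraph G' T (t := j + 1) ht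
  have hU := hT.card_hom_le G' hdeg T (t := j + 1) ht
  generalize Nat.card (T.boxProd H →g G) = X at *
  generalize Nat.card (T.boxProd H →g G') = X' at *
  generalize Nat.card (T →g G') = N at *
  generalize Nat.card (homGraph T G').Dart = Q at *
  generalize Nat.card G'.Dart = D' at *
  generalize Nat.card G.Dart = D at *
  generalize Fintype.card W' = n' at *
  generalize Fintype.card VH = h at *
  have h2 : Q ^ m ≤ X * N ^ s := by
    refine Nat.le_of_mul_le_mul_right ?_ (pow_pos hN h)
    calc Q ^ m * N ^ h ≤ X' * N ^ (2 * m) := h1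
      _ ≤ X * N ^ (2 * m) := by gcongr
      _ = X * N ^ s * N ^ h := by rw [hs]; ring
  have e1 : (j + 1) * h + (j + 2) * m + (j + 1) * s = (3 * (j + 1) + 1) * m := by
    linear_combination (j + 1) * hs.symm
  have e2 : 4 * (j + 1) * m + s = (2 * j + 4) * m + j * h + (j + 1) * s := by
    linear_combination j * hs
  have hmain : D ^ ((j + 1) * h + (j + 2) * m) ≤
      2 ^ (4 * (j + 1) * m + s + (j + 1) * s) * (X * n ^ ((2 * j + 4) * m + j * h)) := by
    refine Nat.le_of_mul_le_mul_right ?_ (show 0 < D ^ ((j + 1) * s) * n ^ ((j + 1) * s) by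
      positivity)
    calc D ^ ((j + 1) * h + (j + 2) * m) * (D ^ ((j + 1) * s) * n ^ ((j + 1) * s))
        = (D ^ (3 * (j + 1) + 1)) ^ m * n ^ ((j + 1) * s) := by
          rw [← mul_assoc, ← pow_add, e1, pow_mul]
      _ ≤ (D' ^ (3 * (j + 1) + 1)) ^ m * n ^ ((j + 1) * s) := by gcongr
      _ ≤ (Q * n' ^ (4 * (j + 1))) ^ m * n ^ ((j + 1) * s) := by gcongr
      _ = Q ^ m * n' ^ (4 * (j + 1) * m) * n ^ ((j + 1) * s) := by rw [mul_pow, ← pow_mul]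
      _ ≤ (X * N ^ s) * n' ^ (4 * (j + 1) * m) * n ^ ((j + 1) * s) := by gcongr
      _ ≤ (X * (n' * k ^ (j + 1)) ^ s) * n' ^ (4 * (j + 1) * m) * n ^ ((j + 1) * s) := by gcongr
      _ = X * n' ^ (4 * (j + 1) * m + s) * (k * n) ^ ((j + 1) * s) := by
          rw [mul_pow, mul_pow, ← pow_mul, pow_add]; ring
      _ ≤ X * (2 * n) ^ (4 * (j + 1) * m + s) * (2 * D) ^ ((j + 1) * s) := by gcongr
      _ = _ := by
          rw [mul_pow, mul_pow, pow_add 2 (4 * (j + 1) * m + s)]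
          nth_rw 2 [e2]
          rw [pow_add n]; ring
  exact hmain.trans (by gcongr)

theorem IsTree.boxProd_inequality (hT : T.IsTree) {t : ℕ} (ht : Fintype.card VT = t + 1)
    (hH : ∀ (W : Type) [Fintype W] [Nonempty W] (G : SimpleGraph W),
      Nat.card G.Dart ^ m * Fintype.card W ^ Fintype.card VH ≤
        Nat.card (H →g G) * Fintype.card W ^ (2 * m))
    [Fintype W] [Nonempty W] (G : SimpleGraph W) :
    Nat.card G.Dart ^ (t * Fintype.card VH + (t + 1) * m) *
        Fintype.card W ^ ((t + 1) * Fintype.card VH) ≤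
      Nat.card (T.boxProd H →g G) *
        Fintype.card W ^ (2 * (t * Fintype.card VH + (t + 1) * m)) := by
  have : Nonempty VT := hT.connected.nonempty
  have hA := hT.card_dart_pow_mul_le G T ht
  have hB := hT.card_dart_pow_le_card_dart_homGraph G T ht
  have hn : 0 < Fintype.card W := Fintype.card_pos
  rcases t with _ | j
  · have hU := hT.card_hom_le G (fun x => (G.degree_lt_card_verts x).le) T ht
    simp only [pow_zero, one_mul, mul_one, mul_zero, zero_add, pow_one, zero_mul] at hA hB hU ⊢
    have hN := le_antisymm hU hA
    have h1 := card_dart_homGraph_pow_mul_le T H hH G (by omega)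
    rw [hN] at h1
    exact le_trans (by gcongr) h1
  rcases le_or_gt (2 * m) (Fintype.card VH) with hle | hlt
  · rcases Nat.eq_zero_or_pos (Fintype.card VH) with hh | hh
    · have hm : m = 0 := by omega
      have : IsEmpty VH := Fintype.card_eq_zero_iff.1 hh
      have : Nonempty (T.boxProd H →g G) :=
        ⟨⟨fun p => isEmptyElim p.2, fun {p} => isEmptyElim p.2⟩⟩
      simp [hm]
    rcases Nat.eq_zero_or_pos (Nat.card G.Dart) with h0 | hD
    · rw [h0, zero_pow (by positivity), zero_mul]
      exact Nat.zero_le _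
    have hN := hT.card_hom_pos hD
    have h1 := card_dart_homGraph_pow_mul_le T H hH G hN
    obtain ⟨s, hs⟩ := Nat.exists_eq_add_of_le hle
    rw [hs] at h1 ⊢
    generalize Nat.card (T.boxProd H →g G) = X at *
    generalize Nat.card (T →g G) = N at *
    generalize Nat.card (homGraph T G).Dart = Q at *
    generalize Nat.card G.Dart = D at *
    generalize Fintype.card W = n at *
    have h2 : Q ^ m * N ^ s ≤ X := by
      refine Nat.le_of_mul_le_mul_right ?_ (pow_pos hN (2 * m))
      calc Q ^ m * N ^ s * N ^ (2 * m) = Q ^ m * N ^ (2 * m + s) := by ring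
        _ ≤ _ := h1
    set t := j + 1
    calc D ^ (t * (2 * m + s) + (t + 1) * m) * n ^ ((t + 1) * (2 * m + s))
        = (D ^ (3 * t + 1)) ^ m * (D ^ t * n) ^ s * n ^ ((t + 1) * (2 * m) + t * s) := by ring
      _ ≤ (Q * n ^ (4 * t)) ^ m * (N * n ^ t) ^ s * n ^ ((t + 1) * (2 * m) + t * s) := by gcongr
      _ = (Q ^ m * N ^ s) * n ^ (2 * (t * (2 * m + s) + (t + 1) * m)) := by ring
      _ ≤ _ := by gcongr
  · obtain ⟨s, hs⟩ := Nat.exists_eq_add_of_le hlt.le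
    have h := sidorenko_of_const (T.boxProd H) _ _ _
      (hT.boxProd_inequality_up_to_const H ht hs (by omega) hH) G
    calc _ ≤ Nat.card (T.boxProd H →g G) *
          Fintype.card W ^ ((2 * j + 4) * m + j * Fintype.card VH) *
          Fintype.card W ^ ((j + 1 + 1) * Fintype.card VH) := by gcongr
      _ = _ := by ring

end Main

end SimpleGraph

/-- if `T` is a tree and `H` is a bipartite graph with Sidorenko's
property, then the Cartesian product `T □ H` also has Sidorenko's property. -/
theorem boxProd_tree_sidorenko (VT VH : Type) [Fintype VT] [Fintype VH]
    (T : SimpleGraph VT) (hT : T.IsTree)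
    (H : SimpleGraph VH) (hbip : H.Colorable 2)
    (hH : ∀ (W : Type) [Fintype W] [Nonempty W] (G : SimpleGraph W),
      (Nat.card (H →g G) : ℝ) / (Fintype.card W : ℝ) ^ (Fintype.card VH) ≥
        (2 * (Nat.card G.edgeSet : ℝ) / (Fintype.card W : ℝ) ^ 2) ^
          (Nat.card H.edgeSet)) :
    ∀ (W : Type) [Fintype W] [Nonempty W] (G : SimpleGraph W),
      (Nat.card (T.boxProd H →g G) : ℝ) /
          (Fintype.card W : ℝ) ^ (Fintype.card (VT × VH)) ≥
        (2 * (Nat.card G.edgeSet : ℝ) / (Fintype.card W : ℝ) ^ 2) ^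
          (Nat.card (T.boxProd H).edgeSet) := by
  intro W _ _ G
  have : Nonempty VT := hT.connected.nonempty
  obtain ⟨t, ht⟩ := Nat.exists_eq_add_one.2 (Fintype.card_pos (α := VT))
  rw [SimpleGraph.density_inequality_iff, hT.card_edgeSet_boxProd H ht, Fintype.card_prod, ht]
  exact hT.boxProd_inequality H ht
    (fun W _ _ G => (SimpleGraph.density_inequality_iff G _ _ _).1 (hH W G)) G
end

section
/- Let H be a bipartite graph with no isolated vertices, let G be a graph, and let G' be obtained from G by splitting each vertex v into ⌈deg(v)/Δ⌉ copies whose neighborhoods partition N(v) (with Δ = 2|E(G)|/|V(G)|). Then the natural projection π : V(G') → V(G) induces an injection from Hom(H,G') into Hom(H,G); in particular |Hom(H,G)| ≥ |Hom(H,G')|. -/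
/-- let `H` be a bipartite graph with no isolated vertices, `G` a
graph, and `G'` obtained from `G` by splitting vertices: there is a projection
`π : V(G') → V(G)` such that adjacency in `G'` projects to adjacency in `G`
(each copy's neighborhood lies in the original neighborhood), and for each edge
`{v,w}` of `G` there is a unique pair of copies `v' ∈ π⁻¹(v)`, `w' ∈ π⁻¹(w)`
adjacent in `G'`. Then composition with `π` is an injection from `Hom(H,G')`
into `Hom(H,G)`; in particular `|Hom(H,G)| ≥ |Hom(H,G')|`. -/
theorem split_hom_injective (VH V V' : Type) [Fintype VH] [Fintype V] [Fintype V']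
    (H : SimpleGraph VH) (hbip : H.Colorable 2)
    (hiso : ∀ x : VH, ∃ y : VH, H.Adj x y)
    (G : SimpleGraph V) (G' : SimpleGraph V') (π : V' → V)
    (hproj : ∀ a b : V', G'.Adj a b → G.Adj (π a) (π b))
    (hlift : ∀ v w : V, G.Adj v w →
      ∃! p : V' × V', π p.1 = v ∧ π p.2 = w ∧ G'.Adj p.1 p.2) :
    Function.Injective (fun f : H →g G' => (π ∘ ⇑f : VH → V)) ∧
      Nat.card (H →g G') ≤ Nat.card (H →g G) := by
  have hinj : Function.Injective (fun f : H →g G' => (π ∘ ⇑f : VH → V)) := by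
    intro f g hfg
    have hπ : ∀ z, π (f z) = π (g z) := congrFun hfg
    refine DFunLike.ext f g fun x => ?_
    obtain ⟨y, hxy⟩ := hiso x
    have hpair : (f x, f y) = (g x, g y) :=
      (hlift _ _ (hproj _ _ (g.map_adj hxy))).unique
        ⟨hπ x, hπ y, f.map_adj hxy⟩ ⟨rfl, rfl, g.map_adj hxy⟩
    exact congrArg Prod.fst hpair
  let p : G' →g G := ⟨π, fun {a b} h => hproj a b h⟩
  have : Finite (H →g G) := DFunLike.finite _
  refine ⟨hinj, Nat.card_le_card_of_injective (fun f => p.comp f) fun f g hfg => ?_⟩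
  exact hinj (congrArg DFunLike.coe hfg)
end

section
/- A bipartite graph H with bipartition A ∪ B is tree-arrangeable (via A) if and only if there exists a neighbor covering subset U ⊆ A which is tree-arrangeable (as an independent set of H). In particular, if U ⊆ A is neighbor covering and T-arrangeable for a tree T on U, then extending T by attaching each a ∈ A\U as a leaf to some u ∈ U with Λ_a ⊆ Λ_u yields a tree T' on A making A T'-arrangeable. -/
/-- `U ⊆ V(H)` is `T`-arrangeable for a tree `T` on `U` if for every pair of
vertices `u, v ∈ U` and the path `P` in `T` connecting them,
`Λ_u ∩ Λ_v = ⋂_{w ∈ P} Λ_w`, where `Λ_x` is the neighborhood of `x` in `H`. -/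
def Arrangeable {V : Type} (H : SimpleGraph V) (U : Set V)
    (T : SimpleGraph U) : Prop :=
  ∀ (u v : U) (p : T.Walk u v), p.IsPath →
    H.neighborSet ↑u ∩ H.neighborSet ↑v = ⋂ w ∈ p.support, H.neighborSet (↑w : V)

namespace SimpleGraph

/-- If the vertices outside `s` have at most one neighbor each, then `G` is acyclic as soon as
the subgraph induced by `s` is. -/
lemma IsAcyclic.of_induce {W : Type*} {G : SimpleGraph W} {s : Set W}
    (h : (G.induce s).IsAcyclic) (hs : ∀ x ∉ s, (G.neighborSet x).Subsingleton) :
    G.IsAcyclic := by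
  intro v c hc
  have hmem : ∀ x ∈ c.support, x ∈ s := by
    intro x hx
    by_contra hxs
    have htwo := hc.ncard_neighborSet_toSubgraph_eq_two hx
    have hsub := (hs x hxs).anti (c.toSubgraph.neighborSet_subset x)
    have : Finite (c.toSubgraph.neighborSet x) := hsub.finite
    have hone := Set.ncard_le_one_iff_subsingleton.2 hsub
    omega
  refine h (c.induce s hmem) (Walk.IsCycle.of_map (f := (Embedding.induce s).toHom) ?_)
  rwa [Walk.map_induce]

variable {V : Type*} {U A : Set V}

/-- The graph on `A` obtained from a graph `T` on `U` by joining each `a ∈ A \ U` to `r a`. -/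
def attachLeaves (T : SimpleGraph U) (r : A → U) : SimpleGraph A where
  Adj x y := (∃ (hx : (x : V) ∈ U) (hy : (y : V) ∈ U), T.Adj ⟨x, hx⟩ ⟨y, hy⟩) ∨
    ((x : V) ∉ U ∧ (r x : V) = y) ∨ ((y : V) ∉ U ∧ (r y : V) = x)
  symm := ⟨by
    rintro x y (⟨hx, hy, h⟩ | h | h)
    · exact .inl ⟨hy, hx, h.symm⟩
    · exact .inr (.inr h)
    · exact .inr (.inl h)⟩
  loopless := ⟨by
    rintro x (⟨_, _, h⟩ | ⟨hx, h⟩ | ⟨hx, h⟩)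
    · exact h.ne rfl
    · exact hx (h ▸ (r x).2)
    · exact hx (h ▸ (r x).2)⟩

/-- The inclusion of `T` into the graph obtained by attaching leaves to it. -/
def attachLeavesHom (T : SimpleGraph U) (r : A → U) (hUA : U ⊆ A) :
    T →g T.attachLeaves r where
  toFun := Set.inclusion hUA
  map_rel' {x y} h := .inl ⟨x.2, y.2, h⟩

lemma IsAcyclic.attachLeaves {T : SimpleGraph U} (hT : T.IsAcyclic) (r : A → U) :
    (T.attachLeaves r).IsAcyclic := by
  refine IsAcyclic.of_induce (s := {a : A | (a : V) ∈ U}) ?_ ?_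
  · let f : (T.attachLeaves r).induce {a : A | (a : V) ∈ U} →g T :=
      { toFun x := ⟨x.1.1, x.2⟩
        map_rel' := by
          rintro x y (⟨_, _, h⟩ | h | h)
          · exact h
          · exact absurd x.2 h.1
          · exact absurd y.2 h.1 }
    refine hT.comap f fun x y h ↦ ?_
    exact Subtype.ext (Subtype.ext (congrArg (fun u : U ↦ (u : V)) h))
  · have hr : ∀ x : A, (x : V) ∉ U → ∀ y, (T.attachLeaves r).Adj x y → (r x : V) = y := by
      rintro x hx y (⟨h, _⟩ | h | h)
      · exact absurd h hx
      · exact h.2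
      · exact absurd (h.2 ▸ (r y).2) hx
    intro x hx y hy z hz
    exact Subtype.ext ((hr x hx y hy).symm.trans (hr x hx z hz))

/-- Every vertex is joined to its attaching vertex by a walk visiting no other vertices. -/
lemma exists_walk_attachLeaves (T : SimpleGraph U) (r : A → U) (hUA : U ⊆ A)
    (hr : ∀ a : A, (a : V) ∈ U → (r a : V) = a) (a : A) :
    ∃ p : (T.attachLeaves r).Walk a (Set.inclusion hUA (r a)),
      ∀ w ∈ p.support, w = a ∨ w = Set.inclusion hUA (r a) := by
  by_cases ha : (a : V) ∈ U
  · have h : a = Set.inclusion hUA (r a) := Subtype.ext (hr a ha).symm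
    exact ⟨Walk.nil.copy rfl h, by simp +contextual⟩
  · have h : (T.attachLeaves r).Adj a (Set.inclusion hUA (r a)) := .inr (.inl ⟨ha, rfl⟩)
    exact ⟨h.toWalk, by simp⟩

/-- A walk in `T` between attaching vertices extends to a walk between the attached vertices. -/
lemma exists_walk_attachLeaves_of_walk {T : SimpleGraph U} {r : A → U} (hUA : U ⊆ A)
    (hr : ∀ a : A, (a : V) ∈ U → (r a : V) = a) {a b : A} (p : T.Walk (r a) (r b)) :
    ∃ q : (T.attachLeaves r).Walk a b,
      ∀ w ∈ q.support, w = a ∨ w = b ∨ ∃ x ∈ p.support, w = Set.inclusion hUA x := by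
  obtain ⟨pa, hpa⟩ := exists_walk_attachLeaves T r hUA hr a
  obtain ⟨pb, hpb⟩ := exists_walk_attachLeaves T r hUA hr b
  obtain ⟨p', hp'⟩ : ∃ p' : (T.attachLeaves r).Walk (Set.inclusion hUA (r a))
      (Set.inclusion hUA (r b)), p'.support = p.support.map (Set.inclusion hUA) :=
    ⟨p.map (attachLeavesHom T r hUA), Walk.support_map _ _⟩
  refine ⟨(pa.append p').append pb.reverse, fun w hw ↦ ?_⟩
  simp only [Walk.mem_support_append_iff, hp', Walk.support_reverse,
    List.mem_reverse, List.mem_map] at hw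
  rcases hw with (hw | ⟨x, hx, rfl⟩) | hw
  · exact (hpa w hw).imp_right fun h ↦ .inr ⟨_, p.start_mem_support, h⟩
  · exact .inr (.inr ⟨x, hx, rfl⟩)
  · exact .inr ((hpb w hw).imp_right fun h ↦ ⟨_, p.end_mem_support, h⟩)

lemma IsTree.attachLeaves {T : SimpleGraph U} (hT : T.IsTree) {r : A → U} (hUA : U ⊆ A)
    (hr : ∀ a : A, (a : V) ∈ U → (r a : V) = a) : (T.attachLeaves r).IsTree where
  connected :=
    { preconnected a b :=
        let ⟨p⟩ := hT.connected.preconnected (r a) (r b)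
        let ⟨q, _⟩ := exists_walk_attachLeaves_of_walk hUA hr p
        ⟨q⟩
      nonempty := hT.connected.nonempty.map (Set.inclusion hUA) }
  isAcyclic := hT.isAcyclic.attachLeaves r

end SimpleGraph

/-- Attaching each vertex `a` as a leaf to a vertex whose neighborhood contains that of `a`
preserves arrangeability. -/
lemma Arrangeable.attachLeaves {V : Type} {H : SimpleGraph V} {U A : Set V}
    {T : SimpleGraph U} (h : Arrangeable H U T) (hT : T.IsTree) {r : A → U} (hUA : U ⊆ A)
    (hr : ∀ a : A, (a : V) ∈ U → (r a : V) = a)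
    (hcov : ∀ a : A, H.neighborSet (a : V) ⊆ H.neighborSet (r a : V)) :
    Arrangeable H A (T.attachLeaves r) := by
  classical
  intro u v p hp
  refine Set.Subset.antisymm ?_ fun b hb ↦ ?_
  · rintro b ⟨hu, hv⟩
    refine Set.mem_iInter₂.2 fun w hw ↦ ?_
    obtain ⟨t, ht⟩ := hT.connected.exists_isPath (r u) (r v)
    have hb : b ∈ ⋂ x ∈ t.support, H.neighborSet (x : V) := by
      rw [← h _ _ t ht]
      exact ⟨hcov u hu, hcov v hv⟩
    obtain ⟨q, hq⟩ := SimpleGraph.exists_walk_attachLeaves_of_walk hUA hr t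
    have hpq : p = q.bypass := congrArg Subtype.val
      (((hT.isAcyclic.attachLeaves r).subsingleton_path u v).elim
        ⟨p, hp⟩ ⟨q.bypass, q.bypass_isPath⟩)
    rcases hq w (q.support_bypass_subset_support (hpq ▸ hw)) with rfl | rfl | ⟨x, hx, rfl⟩
    · exact hu
    · exact hv
    · exact Set.mem_iInter₂.1 hb x hx
  · exact ⟨Set.mem_iInter₂.1 hb u p.start_mem_support, Set.mem_iInter₂.1 hb v p.end_mem_support⟩

/-- a bipartite graph `H` with bipartition `A ∪ B` is
tree-arrangeable via `A` if and only if there exists a neighbor covering subset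
`U ⊆ A` which is tree-arrangeable. In particular, if `U ⊆ A` is neighbor
covering and `T`-arrangeable for a tree `T` on `U`, then there is a tree `T'`
on `A` making `A` `T'`-arrangeable. -/
theorem treeArrangeable_iff_neighborCovering (V : Type) (H : SimpleGraph V)
    (A B : Set V)
    (hcover : ∀ v : V, v ∈ A ∨ v ∈ B) (hdisj : Disjoint A B)
    (hedges : ∀ u w : V, H.Adj u w → (u ∈ A ∧ w ∈ B) ∨ (u ∈ B ∧ w ∈ A)) :
    ((∃ T : SimpleGraph A, T.IsTree ∧ Arrangeable H A T) ↔
      (∃ U : Set V, U ⊆ A ∧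
        (∀ a ∈ A, ∃ u ∈ U, H.neighborSet a ⊆ H.neighborSet u) ∧
        ∃ T : SimpleGraph U, T.IsTree ∧ Arrangeable H U T)) ∧
    (∀ (U : Set V), U ⊆ A →
      (∀ a ∈ A, ∃ u ∈ U, H.neighborSet a ⊆ H.neighborSet u) →
      ∀ T : SimpleGraph U, T.IsTree → Arrangeable H U T →
        ∃ T' : SimpleGraph A, T'.IsTree ∧ Arrangeable H A T') := by
  have extend : ∀ (U : Set V), U ⊆ A →
      (∀ a ∈ A, ∃ u ∈ U, H.neighborSet a ⊆ H.neighborSet u) →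
      ∀ T : SimpleGraph U, T.IsTree → Arrangeable H U T →
        ∃ T' : SimpleGraph A, T'.IsTree ∧ Arrangeable H A T' := by
    intro U hUA hcov T hT harr
    have hex : ∀ a : A, ∃ u : U, ((a : V) ∈ U → (u : V) = a) ∧
        H.neighborSet (a : V) ⊆ H.neighborSet (u : V) := by
      intro a
      by_cases ha : (a : V) ∈ U
      · exact ⟨⟨a, ha⟩, fun _ ↦ rfl, subset_rfl⟩
      · obtain ⟨u, hu, hau⟩ := hcov a a.2
        exact ⟨⟨u, hu⟩, fun h ↦ absurd h ha, hau⟩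
    choose r hr hle using hex
    exact ⟨T.attachLeaves r, hT.attachLeaves hUA hr, harr.attachLeaves hT hUA hr hle⟩
  refine ⟨⟨fun h ↦ ⟨A, subset_rfl, fun a ha ↦ ⟨a, ha, subset_rfl⟩, h⟩, ?_⟩, extend⟩
  rintro ⟨U, hUA, hcov, T, hT, harr⟩
  exact extend U hUA hcov T hT harr
end
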